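/- Fix n, k ≥ 1 and let V_ns be the universal nonsignalling vector space with generators Q(a,b|x,y), unit e_ns, involution fixing each generator, and cone D_ns. Then (V_ns, D_ns, e_ns) is an AOU space: (i) D_ns ∩ −D_ns = {0}; (ii) for every hermitian v ∈ V_ns there exists t > 0 with t·e_ns − v ∈ D_ns; (iii) if v ∈ V_ns satisfies v + ε·e_ns ∈ D_ns for all ε > 0, then v ∈ D_ns. -/

import Mathlib

open scoped ComplexOrder

/-- `x` is a hermitian matrix over a ∗-vector space. -/
def IsHermMat {V ι : Type} [Star V] (x : Matrix ι ι V) : Prop :=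
  ∀ i j, x j i = star (x i j)

/-- A family of cones of matrices over `V`, one for each finite matrix-index type. -/
abbrev ConeFamily (V : Type) : Type 1 :=
  ∀ (ι : Type) [Fintype ι] [DecidableEq ι], Set (Matrix ι ι V)

section Core

variable {V : Type} [AddCommGroup V] [Module ℂ V] [StarAddMonoid V] [StarModule ℂ V]

/-- conjugation `α* x α` of `x ∈ M_ι(V)` by a scalar matrix `α : M_{ι,κ}(ℂ)`. -/
def conjBy {ι κ : Type} [Fintype ι] (α : Matrix ι κ ℂ) (x : Matrix ι ι V) :
    Matrix κ κ V :=
  Matrix.of fun s t => ∑ i, ∑ j, ((starRingEnd ℂ) (α i s) * α j t) • x i j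

/-- `C` is a matrix ordering on the ∗-vector space `V`. -/
structure IsMatrixOrdering (C : ConeFamily V) : Prop where
  herm_mem : ∀ (ι : Type) [Fintype ι] [DecidableEq ι], ∀ x ∈ C ι, IsHermMat x
  add_mem : ∀ (ι : Type) [Fintype ι] [DecidableEq ι], ∀ x ∈ C ι, ∀ y ∈ C ι, x + y ∈ C ι
  smul_mem : ∀ (ι : Type) [Fintype ι] [DecidableEq ι], ∀ r : ℝ, 0 ≤ r → ∀ x ∈ C ι,
    (r : ℂ) • x ∈ C ι
  conj_mem : ∀ (ι κ : Type) [Fintype ι] [DecidableEq ι] [Fintype κ] [DecidableEq κ],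
    ∀ (α : Matrix ι κ ℂ), ∀ x ∈ C ι, conjBy α x ∈ C κ

/-- the diagonal matrix `I_ι ⊗ e` with `e` in every diagonal entry. -/
def unitMat {ι : Type} [DecidableEq ι] (e : V) : Matrix ι ι V :=
  Matrix.of fun i j => if i = j then e else 0

/-- membership of an element of `V` in the ground-level cone `C_1`. -/
def Mem1 (C : ConeFamily V) (v : V) : Prop :=
  (Matrix.of fun _ _ => v : Matrix (Fin 1) (Fin 1) V) ∈ C (Fin 1)

/-- `(V, C, e)` is an (abstract) operator system: `C` is a proper matrix ordering and
`e` is an Archimedean matrix order unit. -/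
structure IsOperatorSystem (C : ConeFamily V) (e : V) extends IsMatrixOrdering C : Prop where
  proper : ∀ (ι : Type) [Fintype ι] [DecidableEq ι], ∀ x ∈ C ι, -x ∈ C ι → x = 0
  unit_mem : Mem1 C e
  orderUnit : ∀ (ι : Type) [Fintype ι] [DecidableEq ι], ∀ x : Matrix ι ι V, IsHermMat x →
    ∃ t : ℝ, 0 < t ∧ (t : ℂ) • (unitMat e : Matrix ι ι V) - x ∈ C ι
  arch : ∀ (ι : Type) [Fintype ι] [DecidableEq ι], ∀ x : Matrix ι ι V,
    (∀ ε : ℝ, 0 < ε → x + (ε : ℂ) • (unitMat e : Matrix ι ι V) ∈ C ι) → x ∈ C ι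

/-- `p` is a positive contraction: `p ∈ C_1` and `e - p ∈ C_1`. -/
def IsPosCon (C : ConeFamily V) (e p : V) : Prop :=
  Mem1 C p ∧ Mem1 C (e - p)

/-- the `2 × 2` diagonal matrix `p ⊕ q` over `V`. -/
def diagPQ (p q : V) : Matrix (Fin 2) (Fin 2) V :=
  Matrix.of fun s t => if s = t then (if s = 0 then p else q) else 0

/-- `I_ι ⊗ y`. -/
def idKron {ι κ : Type} [DecidableEq ι] (y : Matrix κ κ V) : Matrix (ι × κ) (ι × κ) V :=
  Matrix.of fun a b => if a.1 = b.1 then y a.2 b.2 else 0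

/-- `x ⊗ J_κ`, the Kronecker product of `x` with the all-ones matrix. -/
def onesKron {ι κ : Type} (x : Matrix ι ι V) : Matrix (ι × κ) (ι × κ) V :=
  Matrix.of fun a b => x a.1 b.1

/-- the cone `C(p)_ι ⊆ M_{ι × 2}(V)` associated to a positive contraction `p`. -/
def coneP (C : ConeFamily V) (e p : V) (ι : Type) [Fintype ι] [DecidableEq ι] :
    Set (Matrix (ι × Fin 2) (ι × Fin 2) V) :=
  {x | IsHermMat x ∧ ∀ ε : ℝ, 0 < ε → ∃ t : ℝ, 0 < t ∧
    x + (ε : ℂ) • idKron (diagPQ p (e - p)) + (t : ℂ) • idKron (diagPQ (e - p) p)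
      ∈ C (ι × Fin 2)}

end Core
section AOU

variable {V : Type} [AddCommGroup V] [Module ℂ V] [StarAddMonoid V] [StarModule ℂ V]

/-- `(V, C, e)` is an Archimedean order unit (AOU) space. -/
structure IsAOU (C : Set V) (e : V) : Prop where
  herm : ∀ v ∈ C, star v = v
  add_mem : ∀ v ∈ C, ∀ w ∈ C, v + w ∈ C
  smul_mem : ∀ r : ℝ, 0 ≤ r → ∀ v ∈ C, (r : ℂ) • v ∈ C
  proper : ∀ v ∈ C, -v ∈ C → v = 0
  unit_mem : e ∈ C
  orderUnit : ∀ v : V, star v = v → ∃ t : ℝ, 0 < t ∧ (t : ℂ) • e - v ∈ C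
  arch : ∀ v : V, (∀ ε : ℝ, 0 < ε → v + (ε : ℂ) • e ∈ C) → v ∈ C

/-- the cone `D^max_ι` of matrices of the form `(Σ_i conj(a(i,s))·a(i,t)·v_i)_{s,t}`
with `v_i ∈ C`. -/
def Dmax (C : Set V) (ι : Type) [Fintype ι] [DecidableEq ι] : Set (Matrix ι ι V) :=
  {x | ∃ (r : ℕ) (a : Fin r → ι → ℂ) (v : Fin r → V), (∀ i, v i ∈ C) ∧
    x = Matrix.of fun s t => ∑ i, ((starRingEnd ℂ) (a i s) * a i t) • v i}

/-- the maximal matrix ordering `C^max` of the AOU space `(V, C, e)`: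
the Archimedeanization of `D^max`. -/
def CmaxFam (C : Set V) (e : V) : ConeFamily V :=
  fun ι _ _ =>
    {x | IsHermMat x ∧ ∀ ε : ℝ, 0 < ε → x + (ε : ℂ) • unitMat e ∈ Dmax C ι}

end AOU
namespace NSpace

variable (n k : ℕ)

/-- index set for the generators `Q̃(a,b|x,y)`. -/
abbrev Idx (n k : ℕ) := Fin k × Fin k × Fin n × Fin n

/-- the free vector space `W̃ = ℂ^{k²n²}`. -/
abbrev Wt (n k : ℕ) := Idx n k → ℂ

/-- the canonical basis vector `Q̃(a,b|x,y)`. -/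
def gen {n k : ℕ} (a b : Fin k) (x y : Fin n) : Wt n k := Pi.single (a, b, x, y) 1

/-- the set of nonsignalling relations. -/
def relSet (n k : ℕ) : Set (Wt n k) :=
  {u | ∃ x y x' y', u = (∑ a, ∑ b, gen a b x y) - (∑ a, ∑ b, gen a b x' y')} ∪
  {u | ∃ a x z w, u = (∑ c, gen a c x z) - (∑ c, gen a c x w)} ∪
  {u | ∃ b y z w, u = (∑ d, gen d b z y) - (∑ d, gen d b w y)}

/-- the subspace `J` spanned by the nonsignalling relations. -/
noncomputable def Jrel (n k : ℕ) : Submodule ℂ (Wt n k) := Submodule.span ℂ (relSet n k)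

/-- the universal nonsignalling vector space `V_ns = W̃ / J`. -/
abbrev Vns (n k : ℕ) := Wt n k ⧸ Jrel n k

/-- the generator `Q(a,b|x,y) = Q̃(a,b|x,y) + J` of `V_ns`. -/
noncomputable def Qg {n k : ℕ} (a b : Fin k) (x y : Fin n) : Vns n k :=
  Submodule.Quotient.mk (gen a b x y)

/-- the unit `e_ns = Σ_{a,b} Q(a,b|x,y)` of `V_ns`. -/
noncomputable def ens (n k : ℕ) [NeZero n] : Vns n k := ∑ a, ∑ b, Qg (n := n) (k := k) a b 0 0

/-- the coordinatewise conjugation on `W̃`. -/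
def starW (n k : ℕ) : Wt n k → Wt n k := fun w i => (starRingEnd ℂ) (w i)

theorem starW_gen {n k : ℕ} (a b : Fin k) (x y : Fin n) :
    starW n k (gen a b x y) = gen a b x y := by
  funext i
  by_cases h : i = (a, b, x, y) <;> simp [starW, gen, Pi.single_apply, h]

theorem starW_mem_Jrel {n k : ℕ} {u : Wt n k} (hu : u ∈ Jrel n k) :
    starW n k u ∈ Jrel n k := by
  have hsub : ∀ u v : Wt n k, starW n k (u - v) = starW n k u - starW n k v := by
    intro u v; funext i; simp [starW]
  have hsum : ∀ {α : Type} (s : Finset α) (f : α → Wt n k),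
      starW n k (∑ j ∈ s, f j) = ∑ j ∈ s, starW n k (f j) := by
    intro α s f; funext i
    simp [starW, Finset.sum_apply, map_sum]
  induction hu using Submodule.span_induction with
  | mem s hs =>
    have hfix : starW n k s = s := by
      rcases hs with (⟨x, y, x', y', rfl⟩ | ⟨a, x, z, w, rfl⟩) | ⟨b, y, z, w, rfl⟩ <;>
        simp [hsub, hsum, starW_gen]
    rw [hfix]; exact Submodule.subset_span hs
  | zero =>
    have : starW n k 0 = 0 := by funext i; simp [starW]
    rw [this]; exact zero_mem _
  | add u v _ _ ihu ihv =>
    have : starW n k (u + v) = starW n k u + starW n k v := by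
      funext i; simp [starW]
    rw [this]; exact add_mem ihu ihv
  | smul c u _ ih =>
    have : starW n k (c • u) = (starRingEnd ℂ) c • starW n k u := by
      funext i; simp [starW]
    rw [this]; exact Submodule.smul_mem _ _ ih

/-- the conjugate-linear involution on `V_ns` fixing each generator. -/
noncomputable def starVns {n k : ℕ} : Vns n k → Vns n k := fun v =>
  Quotient.liftOn' v
    (fun w => (Submodule.Quotient.mk (starW n k w) : Vns n k))
    (fun a b hab => by
      rw [Submodule.quotientRel_def] at hab
      apply Quotient.sound'
      rw [Submodule.quotientRel_def]
      have h : starW n k a - starW n k b = starW n k (a - b) := by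
        funext i; simp [starW]
      rw [h]
      exact starW_mem_Jrel hab)

noncomputable instance {n k : ℕ} : StarAddMonoid (Vns n k) where
  star := starVns
  star_involutive := by
    intro v
    obtain ⟨w, rfl⟩ := Submodule.Quotient.mk_surjective _ v
    show Submodule.Quotient.mk (starW n k (starW n k w)) = Submodule.Quotient.mk w
    congr 1
    funext i; simp [starW]
  star_add := by
    intro v v'
    obtain ⟨w, rfl⟩ := Submodule.Quotient.mk_surjective _ v
    obtain ⟨w', rfl⟩ := Submodule.Quotient.mk_surjective _ v'
    show Submodule.Quotient.mk (starW n k (w + w')) =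
      (Submodule.Quotient.mk (starW n k w) : Vns n k) + Submodule.Quotient.mk (starW n k w')
    rw [← Submodule.Quotient.mk_add]
    congr 1
    funext i; simp [starW]

instance {n k : ℕ} : StarModule ℂ (Vns n k) where
  star_smul := by
    intro c v
    obtain ⟨w, rfl⟩ := Submodule.Quotient.mk_surjective _ v
    show Submodule.Quotient.mk (starW n k (c • w)) =
      star c • (Submodule.Quotient.mk (starW n k w) : Vns n k)
    rw [← Submodule.Quotient.mk_smul]
    congr 1
    funext i; simp [starW, mul_comm]

theorem star_Qg {n k : ℕ} (a b : Fin k) (x y : Fin n) :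
    star (Qg a b x y) = Qg a b x y := by
  show Submodule.Quotient.mk (starW n k (gen a b x y)) = Qg a b x y
  rw [starW_gen]; rfl

/-- the cone `D_ns` generated by the generators `Q(a,b|x,y)`. -/
def Dns (n k : ℕ) : Set (Vns n k) :=
  {v | ∃ t : Idx n k → ℝ, (∀ i, 0 ≤ t i) ∧
    v = ∑ i : Idx n k, (t i : ℂ) • Qg i.1 i.2.1 i.2.2.1 i.2.2.2}

end NSpace

namespace NSpace

open Filter Topology

variable {n k : ℕ}

theorem sum_eq_zero_of_mem_Jrel {u : Wt n k} (hu : u ∈ Jrel n k) : ∑ i, u i = 0 := by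
  have hle : Jrel n k ≤
      LinearMap.ker (∑ i : Idx n k, LinearMap.proj (R := ℂ) (φ := fun _ => ℂ) i) := by
    refine Submodule.span_le.2 ?_
    have key : ∀ (a b : Fin k) (x y : Fin n),
        (∑ i : Idx n k, LinearMap.proj (R := ℂ) (φ := fun _ => ℂ) i) (gen a b x y) = 1 := by
      intro a b x y
      simp [gen]
    rintro u ((⟨x, y, x', y', rfl⟩ | ⟨a, x, z, w, rfl⟩) | ⟨b, y, z, w, rfl⟩) <;>
      simp only [SetLike.mem_coe, LinearMap.mem_ker, map_sub, map_sum, key, sub_self]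
  simpa using hle hu

theorem mk_eq_sum_smul_Qg (w : Wt n k) :
    (Submodule.Quotient.mk w : Vns n k) = ∑ i, w i • Qg i.1 i.2.1 i.2.2.1 i.2.2.2 := by
  have h : w = ∑ i, w i • gen i.1 i.2.1 i.2.2.1 i.2.2.2 := by
    conv_lhs => rw [pi_eq_sum_univ' w]
    refine Finset.sum_congr rfl fun i _ => ?_
    funext j
    simp [gen, Pi.single_apply, eq_comm]
  conv_lhs => rw [h]
  change (Jrel n k).mkQ _ = _
  simp only [map_sum, map_smul]
  rfl

theorem mem_Dns_iff {v : Vns n k} :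
    v ∈ Dns n k ↔ ∃ t : Idx n k → ℝ, (∀ i, 0 ≤ t i) ∧
      v = Submodule.Quotient.mk (fun i => (t i : ℂ)) := by
  simp only [mk_eq_sum_smul_Qg]
  rfl

theorem sum_Qg_eq_ens [NeZero n] (x y : Fin n) :
    ∑ a, ∑ b, Qg (k := k) a b x y = ens n k := by
  have h : (∑ a, ∑ b, gen (k := k) a b x y) - ∑ a, ∑ b, gen (k := k) a b 0 0 ∈ Jrel n k :=
    Submodule.subset_span (Or.inl (Or.inl ⟨x, y, 0, 0, rfl⟩))
  have h' := (Submodule.Quotient.eq (Jrel n k)).2 h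
  change (Jrel n k).mkQ _ = (Jrel n k).mkQ _ at h'
  simp only [map_sum] at h'
  exact h'

theorem sum_univ_Qg [NeZero n] :
    ∑ i : Idx n k, (Qg i.1 i.2.1 i.2.2.1 i.2.2.2 : Vns n k) = ((n : ℂ) * n) • ens n k := by
  have h : ∑ i : Idx n k, (Qg i.1 i.2.1 i.2.2.1 i.2.2.2 : Vns n k)
      = ∑ p : Fin n × Fin n, ∑ q : Fin k × Fin k, Qg q.1 q.2 p.1 p.2 := by
    rw [Finset.sum_comm, ← Fintype.sum_prod_type']
    exact Fintype.sum_equiv (Equiv.prodAssoc _ _ _).symm _ _ fun _ => rfl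
  simp only [h, Fintype.sum_prod_type, sum_Qg_eq_ens, Finset.sum_const, Finset.card_univ,
    Fintype.card_prod, Fintype.card_fin, mul_smul, Nat.cast_smul_eq_nsmul]

theorem exists_real_rep_of_star_eq {v : Vns n k} (hv : star v = v) :
    ∃ r : Idx n k → ℝ, v = Submodule.Quotient.mk (fun i => (r i : ℂ)) := by
  obtain ⟨w, rfl⟩ := Submodule.Quotient.mk_surjective _ v
  have hv' : (Submodule.Quotient.mk (starW n k w) : Vns n k) = Submodule.Quotient.mk w := hv
  refine ⟨fun i => (w i).re, ?_⟩
  have h : (fun i => ((w i).re : ℂ)) = (1 / 2 : ℂ) • (w + starW n k w) := by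
    funext i
    simp [starW, Complex.add_conj]
  rw [h, Submodule.Quotient.mk_smul, Submodule.Quotient.mk_add, hv', ← two_smul ℂ, smul_smul]
  norm_num

theorem Dns_proper {v : Vns n k} (hv : v ∈ Dns n k) (hv' : -v ∈ Dns n k) : v = 0 := by
  obtain ⟨t, ht, rfl⟩ := mem_Dns_iff.1 hv
  obtain ⟨s, hs, h⟩ := mem_Dns_iff.1 hv'
  rw [← Submodule.Quotient.mk_neg, Submodule.Quotient.eq] at h
  have h0 := sum_eq_zero_of_mem_Jrel h
  have h1 : ∑ i, (-t i - s i) = 0 := by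
    rw [← Complex.ofReal_inj]
    push_cast
    simpa using h0
  have h2 : ∀ i, -t i - s i = 0 := fun i =>
    (Finset.sum_eq_zero_iff_of_nonpos (fun i _ => by linarith [ht i, hs i])).1 h1 i
      (Finset.mem_univ i)
  have h3 : (fun i => (t i : ℂ)) = 0 := by
    funext i
    have : t i = 0 := by linarith [ht i, hs i, h2 i]
    simp [this]
  rw [h3, Submodule.Quotient.mk_zero]

theorem Dns_orderUnit [NeZero n] {v : Vns n k} (hv : star v = v) :
    ∃ t : ℝ, 0 < t ∧ (t : ℂ) • ens n k - v ∈ Dns n k := by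
  obtain ⟨r, rfl⟩ := exists_real_rep_of_star_eq hv
  set M : ℝ := 1 + ∑ i, |r i|
  have hM : 0 < M := by positivity
  have hr : ∀ i, r i ≤ M := fun i => by
    have := Finset.single_le_sum (f := fun i => |r i|) (fun i _ => abs_nonneg _)
      (Finset.mem_univ i)
    simp only [M]
    linarith [le_abs_self (r i)]
  have hn : (0 : ℝ) < n := Nat.cast_pos.2 (NeZero.pos n)
  refine ⟨M * (n * n), by positivity, fun i => M - r i, fun i => sub_nonneg.2 (hr i), ?_⟩
  simp only [mk_eq_sum_smul_Qg, Complex.ofReal_sub, sub_smul, Finset.sum_sub_distrib,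
    ← Finset.smul_sum, sum_univ_Qg, smul_smul]
  push_cast
  rfl

theorem Dns_archimedean {e v : Vns n k}
    (h : ∀ ε : ℝ, 0 < ε → v + (ε : ℂ) • e ∈ Dns n k) : v ∈ Dns n k := by
  obtain ⟨w, rfl⟩ := Submodule.Quotient.mk_surjective _ v
  obtain ⟨u, rfl⟩ := Submodule.Quotient.mk_surjective _ e
  have hε : ∀ m : ℕ, (0 : ℝ) < 1 / ((m : ℝ) + 1) := fun m => Nat.one_div_pos_of_nat
  choose t ht hteq using fun m : ℕ => mem_Dns_iff.1 (h _ (hε m))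
  have hJ : ∀ m : ℕ, w + ((1 / ((m : ℝ) + 1) : ℝ) : ℂ) • u - (fun i => (t m i : ℂ)) ∈ Jrel n k :=
    fun m => by
      rw [← Submodule.Quotient.eq, ← hteq, Submodule.Quotient.mk_add, Submodule.Quotient.mk_smul]
  set R : ℝ := |∑ i, (w i).re| + |∑ i, (u i).re|
  have hsum : ∀ m, ∑ i, t m i ≤ R := fun m => by
    have h0 := congrArg Complex.re (sum_eq_zero_of_mem_Jrel (hJ m))
    simp only [Pi.sub_apply, Pi.add_apply, Pi.smul_apply, smul_eq_mul, Complex.re_sum,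
      Complex.sub_re, Complex.add_re, Complex.re_ofReal_mul, Complex.ofReal_re,
      Finset.sum_sub_distrib, Finset.sum_add_distrib, ← Finset.mul_sum, Complex.zero_re] at h0
    have h1 : 1 / ((m : ℝ) + 1) ≤ 1 := by
      rw [div_le_one (by positivity)]
      linarith [(Nat.cast_nonneg m : (0 : ℝ) ≤ m)]
    have h2 : 1 / ((m : ℝ) + 1) * ∑ i, (u i).re ≤ |∑ i, (u i).re| :=
      (mul_le_mul_of_nonneg_left (le_abs_self _) (hε m).le).trans
        (mul_le_of_le_one_left (abs_nonneg _) h1)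
    simp only [R]
    linarith [le_abs_self (∑ i, (w i).re)]
  have hK : ∀ m, t m ∈ Set.Icc (0 : Idx n k → ℝ) (fun _ => R) := fun m =>
    ⟨ht m, fun i =>
      (Finset.single_le_sum (fun i _ => ht m i) (Finset.mem_univ i)).trans (hsum m)⟩
  obtain ⟨s, hs, φ, hφ, hlim⟩ := isCompact_Icc.tendsto_subseq hK
  refine mem_Dns_iff.2 ⟨s, hs.1, (Submodule.Quotient.eq _).2 ?_⟩
  have hcl : IsClosed (Jrel n k : Set (Wt n k)) := Submodule.closed_of_finiteDimensional _
  refine hcl.mem_of_tendsto (f := fun m => w + ((1 / (((φ m : ℕ) : ℝ) + 1) : ℝ) : ℂ) • u -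
    (fun i => (t (φ m) i : ℂ))) (b := atTop) ?_ (Eventually.of_forall fun m => hJ (φ m))
  have hofReal : Tendsto (fun m => ((1 / (((φ m : ℕ) : ℝ) + 1) : ℝ) : ℂ)) atTop (𝓝 0) := by
    have := (Complex.continuous_ofReal.tendsto 0).comp
      ((tendsto_one_div_add_atTop_nhds_zero_nat (𝕜 := ℝ)).comp hφ.tendsto_atTop)
    rw [Complex.ofReal_zero] at this
    exact this
  have htlim : Tendsto (fun m => (fun i => (t (φ m) i : ℂ))) atTop (𝓝 fun i => (s i : ℂ)) :=
    tendsto_pi_nhds.2 fun i =>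
      (Complex.continuous_ofReal.tendsto _).comp (tendsto_pi_nhds.1 hlim i)
  simpa using (tendsto_const_nhds.add (hofReal.smul_const u)).sub htlim

end NSpace

open NSpace

/-- `(V_ns, D_ns, e_ns)` is an AOU space. -/
theorem stmt_14 (n k : ℕ) [NeZero n] [NeZero k] :
    IsAOU (Dns n k) (ens n k) where
  herm := by
    rintro v ⟨t, -, rfl⟩
    simp [star_sum, star_smul, star_Qg]
  add_mem := by
    rintro v ⟨t, ht, rfl⟩ w ⟨s, hs, rfl⟩
    exact ⟨fun i => t i + s i, fun i => add_nonneg (ht i) (hs i), by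
      simp [add_smul, Finset.sum_add_distrib]⟩
  smul_mem := by
    rintro r hr v ⟨t, ht, rfl⟩
    exact ⟨fun i => r * t i, fun i => mul_nonneg hr (ht i), by
      simp only [Finset.smul_sum, smul_smul, Complex.ofReal_mul]⟩
  proper := fun _ => Dns_proper
  unit_mem := by
    have hn : (n : ℂ) ≠ 0 := Nat.cast_ne_zero.2 (NeZero.ne n)
    refine ⟨fun _ => ((n : ℝ) * n)⁻¹, fun _ => by positivity, ?_⟩
    rw [← Finset.smul_sum, sum_univ_Qg, smul_smul]
    push_cast
    rw [inv_mul_cancel₀ (mul_ne_zero hn hn), one_smul]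
  orderUnit := fun _ => Dns_orderUnit
  arch := fun _ => Dns_archimedean
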